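/- arXiv:2603.14548 — 3 statements merged into one kernel-verified Lean document; each statement's English description precedes it below -/
import Mathlib

section
/- For every integer n ≥ 0, I_n = (2/3)^n · J_n where J_n = ∑_{k=0}^{⌊n/2⌋} C(n, 2k)·C(2k, k)/16^k; moreover J_n > 0 for all n ≥ 0 and J_0 = J_1 = 1. -/
/-- `I n = (1/(2π))·∫_0^{2π} ((2 + sin θ)/3)^n dθ`. -/
noncomputable def Iavg (n : ℕ) : ℝ :=
  (1 / (2 * Real.pi)) * ∫ θ in (0 : ℝ)..(2 * Real.pi), ((2 + Real.sin θ) / 3) ^ n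

/-- The binomial sum `J_n = ∑_{k=0}^{⌊n/2⌋} C(n,2k)·C(2k,k)/16^k`. -/
noncomputable def Jsum (n : ℕ) : ℝ :=
  ∑ k ∈ Finset.range (n / 2 + 1),
    (n.choose (2 * k) : ℝ) * ((2 * k).choose k : ℝ) / 16 ^ k

theorem integral_sin_pow_odd_two_pi (k : ℕ) :
    ∫ θ in (0 : ℝ)..(2 * Real.pi), Real.sin θ ^ (2 * k + 1) = 0 := by
  induction k with
  | zero => simp
  | succ k ih =>
    rw [show 2 * (k + 1) + 1 = (2 * k + 1) + 2 by ring, integral_sin_pow, ih]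
    simp

theorem integral_sin_pow_even_two_pi (k : ℕ) :
    ∫ θ in (0 : ℝ)..(2 * Real.pi), Real.sin θ ^ (2 * k) =
      2 * Real.pi * (((2 * k).choose k : ℝ) / 4 ^ k) := by
  induction k with
  | zero => simp
  | succ k ih =>
    have h : ((k : ℝ) + 1) * ((2 * (k + 1)).choose (k + 1) : ℝ) =
        2 * (2 * k + 1) * ((2 * k).choose k : ℝ) := by
      exact_mod_cast Nat.succ_mul_centralBinom_succ k
    have h' : ((2 * (k + 1)).choose (k + 1) : ℝ) =
        2 * (2 * k + 1) * ((2 * k).choose k : ℝ) / (k + 1) := by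
      rw [← h]
      field_simp
    rw [h', show 2 * (k + 1) = 2 * k + 2 by ring, integral_sin_pow, ih]
    simp only [Real.sin_zero, Real.sin_two_pi, pow_succ, mul_zero, zero_mul, sub_zero,
      zero_div, zero_add]
    push_cast
    field_simp
    ring

theorem sum_range_eq_sum_even {f : ℕ → ℝ} (hf : ∀ k, f (2 * k + 1) = 0) (n : ℕ) :
    ∑ m ∈ Finset.range (n + 1), f m = ∑ k ∈ Finset.range (n / 2 + 1), f (2 * k) := by
  symm
  refine Finset.sum_of_injOn (fun k => 2 * k) ?_ ?_ ?_ ?_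
  · intro a _ b _ hab
    simpa using hab
  · intro k hk
    simp only [Finset.coe_range, Set.mem_Iio] at hk ⊢
    omega
  · intro m hm hm'
    obtain ⟨k, rfl | rfl⟩ := Nat.even_or_odd' m
    · refine absurd ⟨k, ?_, rfl⟩ hm'
      simp only [Finset.coe_range, Set.mem_Iio, Finset.mem_range] at hm ⊢
      omega
    · exact hf k
  · simp

theorem Iavg_eq (n : ℕ) : Iavg n = (2 / 3 : ℝ) ^ n * Jsum n := by
  have expand (θ : ℝ) : ((2 + Real.sin θ) / 3) ^ n =
      ∑ m ∈ Finset.range (n + 1),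
        ((2 / 3 : ℝ) ^ n * ((n.choose m : ℝ) / 2 ^ m)) * Real.sin θ ^ m := by
    rw [show (2 + Real.sin θ) / 3 = 2 / 3 * (Real.sin θ / 2 + 1) by ring, mul_pow, add_pow,
      Finset.mul_sum]
    refine Finset.sum_congr rfl fun m _ => ?_
    rw [div_pow (Real.sin θ)]
    ring
  unfold Iavg Jsum
  simp_rw [expand]
  rw [intervalIntegral.integral_finsetSum
    fun m _ => Continuous.intervalIntegrable (by fun_prop) _ _]
  simp_rw [intervalIntegral.integral_const_mul]
  rw [sum_range_eq_sum_even (fun k => by rw [integral_sin_pow_odd_two_pi, mul_zero]),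
    Finset.mul_sum, Finset.mul_sum]
  refine Finset.sum_congr rfl fun k _ => ?_
  rw [integral_sin_pow_even_two_pi, pow_mul 2 2 k, show (16 : ℝ) = 2 ^ 2 * 4 by norm_num, mul_pow]
  have := Real.pi_ne_zero
  field_simp

theorem Jsum_pos (n : ℕ) : 0 < Jsum n := by
  refine Finset.sum_pos (fun k hk => ?_) ⟨0, by simp⟩
  have h₁ : 0 < n.choose (2 * k) := Nat.choose_pos (by rw [Finset.mem_range] at hk; omega)
  have h₂ : 0 < (2 * k).choose k := Nat.choose_pos (by omega)
  positivity

/-- Bessel representation: `I_n = (2/3)^n · J_n` with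
`J_n = ∑_{k=0}^{⌊n/2⌋} C(n,2k)·C(2k,k)/16^k`; moreover `J_n > 0` and `J_0 = J_1 = 1`. -/
theorem bessel_representation :
    (∀ n : ℕ, Iavg n = (2 / 3 : ℝ) ^ n * Jsum n) ∧
    (∀ n : ℕ, 0 < Jsum n) ∧ Jsum 0 = 1 ∧ Jsum 1 = 1 := by
  exact ⟨Iavg_eq, Jsum_pos, by simp [Jsum], by simp [Jsum]⟩
end

section
/- The series ∑_{n=1}^∞ I_n/n converges and its sum equals log 6. -/
open MeasureTheory in
/-- Almost every angle has sine different from `1`. -/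
lemma ae_sin_ne_one : ∀ᵐ θ : ℝ, Real.sin θ ≠ 1 := by
  have hc : {θ : ℝ | Real.sin θ = 1}.Countable := by
    refine (Set.countable_range fun k : ℤ => Real.pi / 2 + k * (2 * Real.pi)).mono ?_
    intro θ hθ
    exact Real.sin_eq_one_iff.mp hθ
  exact (hc.ae_notMem volume).mono fun θ hθ => hθ

lemma norm_circleMap_sub_I_sq (θ : ℝ) :
    ‖circleMap 0 1 θ - Complex.I‖ ^ 2 = 2 * (1 - Real.sin θ) := by
  rw [← Complex.normSq_eq_norm_sq, Complex.normSq_apply]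
  simp only [circleMap_zero, Complex.ofReal_one, one_mul, Complex.sub_re, Complex.sub_im,
    Complex.exp_ofReal_mul_I_re, Complex.exp_ofReal_mul_I_im, Complex.I_re, Complex.I_im]
  linear_combination Real.sin_sq_add_cos_sq θ

lemma hasSum_two_add_sin_div_three_pow {θ : ℝ} (hθ : Real.sin θ ≠ 1) :
    HasSum (fun n : ℕ => ((2 + Real.sin θ) / 3) ^ (n + 1) / (n + 1))
      (Real.log 6 - 2 * Real.log ‖circleMap 0 1 θ - Complex.I‖) := by
  have hlt : Real.sin θ < 1 := lt_of_le_of_ne (Real.sin_le_one θ) hθ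
  have habs : |(2 + Real.sin θ) / 3| < 1 := by
    rw [abs_lt]
    constructor <;> linarith [Real.neg_one_le_sin θ]
  convert! Real.hasSum_pow_div_log_of_abs_lt_one habs using 1
  have hsq : 2 * Real.log ‖circleMap 0 1 θ - Complex.I‖ = Real.log (2 * (1 - Real.sin θ)) := by
    rw [← norm_circleMap_sub_I_sq, Real.log_pow, Nat.cast_ofNat]
  have hpos : 0 < 1 - Real.sin θ := sub_pos.mpr hlt
  rw [hsq, ← Real.log_div (by norm_num) (by positivity), ← Real.log_inv]
  congr 1
  rw [show 1 - (2 + Real.sin θ) / 3 = (1 - Real.sin θ) / 3 by ring]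
  field_simp
  norm_num

lemma intervalIntegrable_log_norm_circleMap_sub_I :
    IntervalIntegrable (fun θ => Real.log ‖circleMap 0 1 θ - Complex.I‖) MeasureTheory.volume
      0 (2 * Real.pi) :=
  circleIntegrable_log_norm_sub_const (a := Complex.I) (c := 0) 1

lemma integral_log_norm_circleMap_sub_I :
    ∫ θ in (0 : ℝ)..(2 * Real.pi), Real.log ‖circleMap 0 1 θ - Complex.I‖ = 0 := by
  have h := circleAverage_log_norm_sub_const₁ (a := Complex.I) Complex.norm_I
  rw [Real.circleAverage_def, smul_eq_mul] at h
  exact (mul_eq_zero.mp h).resolve_left (inv_ne_zero Real.two_pi_pos.ne')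

/-- Exact value of the averaging series: `∑_{n≥1} I_n/n = log 6`. -/
theorem averaging_series_eq_log_six :
    HasSum (fun n : ℕ => Iavg (n + 1) / (n + 1)) (Real.log 6) := by
  have hint : IntervalIntegrable
      (fun θ => Real.log 6 - 2 * Real.log ‖circleMap 0 1 θ - Complex.I‖)
      MeasureTheory.volume 0 (2 * Real.pi) :=
    intervalIntegrable_const.sub (intervalIntegrable_log_norm_circleMap_sub_I.const_mul 2)
  have hsum : HasSum
      (fun n : ℕ => ∫ θ in (0 : ℝ)..(2 * Real.pi), ((2 + Real.sin θ) / 3) ^ (n + 1) / (n + 1))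
      (∫ θ in (0 : ℝ)..(2 * Real.pi),
        (Real.log 6 - 2 * Real.log ‖circleMap 0 1 θ - Complex.I‖)) := by
    refine intervalIntegral.hasSum_integral_of_dominated_convergence
      (fun n θ => ((2 + Real.sin θ) / 3) ^ (n + 1) / (n + 1)) ?_ ?_ ?_ ?_ ?_
    · intro n
      exact Continuous.aestronglyMeasurable (by fun_prop)
    · refine fun n => Filter.Eventually.of_forall fun θ _ => (Real.norm_of_nonneg ?_).le
      have : 0 ≤ 2 + Real.sin θ := by linarith [Real.neg_one_le_sin θ]
      positivity
    · exact ae_sin_ne_one.mono fun θ hθ _ => (hasSum_two_add_sin_div_three_pow hθ).summable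
    · refine hint.congr_ae (MeasureTheory.ae_restrict_of_ae ?_)
      exact ae_sin_ne_one.mono fun θ hθ => (hasSum_two_add_sin_div_three_pow hθ).tsum_eq.symm
    · exact ae_sin_ne_one.mono fun θ hθ _ => hasSum_two_add_sin_div_three_pow hθ
  convert! hsum.mul_left (1 / (2 * Real.pi)) using 1
  · ext n
    rw [Iavg, intervalIntegral.integral_div, mul_div_assoc]
  · rw [intervalIntegral.integral_sub intervalIntegrable_const
      (intervalIntegrable_log_norm_circleMap_sub_I.const_mul 2),
      intervalIntegral.integral_const_mul, integral_log_norm_circleMap_sub_I,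
      intervalIntegral.integral_const, smul_eq_mul]
    field_simp
    ring
end

section
/- (1/(2π))·∫_0^{2π} log(3/(1 − sin θ)) dθ = log 6; equivalently, the average over [0, 2π] of −log(1 − (2 + sin θ)/3) equals log 6. -/
/-- `log ∘ sin` is `π`-periodic, since `Real.log` ignores signs. -/
theorem log_sin_periodic : Function.Periodic (fun x : ℝ => Real.log (Real.sin x)) Real.pi := by
  intro x
  simp [Real.sin_add_pi, Real.log_neg_eq_log]

theorem one_sub_sin_eq (θ : ℝ) :
    1 - Real.sin θ = 2 * Real.sin (θ / 2 - Real.pi / 4) ^ 2 := by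
  rw [Real.sin_sq_eq_half_sub, show 2 * (θ / 2 - Real.pi / 4) = θ - Real.pi / 2 by ring,
    Real.cos_sub_pi_div_two]
  ring

theorem integral_log_sin_half_sub :
    ∫ θ in (0 : ℝ)..(2 * Real.pi), Real.log (Real.sin (θ / 2 - Real.pi / 4)) =
      -(2 * Real.pi * Real.log 2) := by
  have h := log_sin_periodic.intervalIntegral_add_eq (-(Real.pi / 4)) 0
  rw [zero_add, integral_log_sin_zero_pi] at h
  rw [intervalIntegral.integral_comp_div_sub (fun x => Real.log (Real.sin x)) two_ne_zero,
    show (0 : ℝ) / 2 - Real.pi / 4 = -(Real.pi / 4) by ring,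
    show 2 * Real.pi / 2 - Real.pi / 4 = -(Real.pi / 4) + Real.pi by ring, h, smul_eq_mul]
  ring

theorem intervalIntegrable_log_sin_half_sub (a b : ℝ) :
    IntervalIntegrable (fun θ : ℝ => Real.log (Real.sin (θ / 2 - Real.pi / 4)))
      MeasureTheory.volume a b := by
  have h : MeromorphicOn (fun θ : ℝ => Real.sin (θ / 2 - Real.pi / 4)) (Set.uIcc a b) :=
    AnalyticOnNhd.meromorphicOn fun x _ => by fun_prop
  exact h.intervalIntegrable_log

theorem log_three_div_one_sub_sin {θ : ℝ} (h : Real.sin (θ / 2 - Real.pi / 4) ≠ 0) :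
    Real.log (3 / (1 - Real.sin θ)) =
      Real.log 3 - Real.log 2 - 2 * Real.log (Real.sin (θ / 2 - Real.pi / 4)) := by
  rw [one_sub_sin_eq, Real.log_div (by norm_num) (by positivity),
    Real.log_mul (by norm_num) (by positivity), Real.log_pow]
  push_cast
  ring

/-- `(1/(2π))·∫_0^{2π} log(3/(1 − sin θ)) dθ = log 6`. -/
theorem average_log_eq_log_six :
    (1 / (2 * Real.pi)) *
      (∫ θ in (0 : ℝ)..(2 * Real.pi), Real.log (3 / (1 - Real.sin θ))) = Real.log 6 := by
  have hae : ∀ᵐ θ : ℝ, θ ∈ Set.uIoc 0 (2 * Real.pi) → Real.log (3 / (1 - Real.sin θ)) =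
      Real.log 3 - Real.log 2 - 2 * Real.log (Real.sin (θ / 2 - Real.pi / 4)) := by
    filter_upwards [MeasureTheory.Measure.ae_ne MeasureTheory.volume (Real.pi / 2)] with θ hne hθ
    rw [Set.uIoc_of_le Real.two_pi_pos.le] at hθ
    refine log_three_div_one_sub_sin fun h => hne ?_
    have := (Real.sin_eq_zero_iff_of_lt_of_lt (by linarith [hθ.1, Real.pi_pos])
      (by linarith [hθ.2, Real.pi_pos])).1 h
    linarith
  rw [intervalIntegral.integral_congr_ae hae, intervalIntegral.integral_sub (by simp)
      ((intervalIntegrable_log_sin_half_sub _ _).const_mul 2),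
    intervalIntegral.integral_const, intervalIntegral.integral_const_mul,
    integral_log_sin_half_sub, smul_eq_mul, show (6 : ℝ) = 3 * 2 by norm_num,
    Real.log_mul (by norm_num) (by norm_num)]
  field_simp
  ring
end
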